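/- arXiv:1810.00993 — 4 statements merged into one kernel-verified Lean document; each statement's English description precedes it below -/
import Mathlib

section
/- For all n ≥ 2, p(2n+1, n−1) = 2·E(2n, n−2) + (1/6)·Σ C(2n+1,k)·C(2n+1−k,ℓ)·EC((k−1)/2)·EC((ℓ−1)/2)·EC((2n−k−ℓ)/2), where the sum is over all odd k and ℓ with 1 ≤ k ≤ 2n−1 and 1 ≤ ℓ ≤ 2n+1−k, and C(·,·) denotes the binomial coefficient. -/
open Finset
open scoped Classical

/-- The one-line word of a permutation of `Fin n`, with values in `{1, …, n}`. -/
def permWord {n : ℕ} (π : Equiv.Perm (Fin n)) : List ℕ :=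
  (List.finRange n).map fun i => (π i : ℕ) + 1

/-- The set of (0-indexed) ascent positions of a word. Position `i` (for
`0 ≤ i ≤ length - 2`) is an ascent if `w_i < w_{i+1}`. -/
def ascentSet (w : List ℕ) : Finset ℕ :=
  (Finset.range (w.length - 1)).filter fun i => w.getD i 0 < w.getD (i + 1) 0

/-- The set of (0-indexed) descent positions of a word. Position `i` (for
`0 ≤ i ≤ length - 2`) is a descent if `w_i > w_{i+1}`. -/
def descentSet (w : List ℕ) : Finset ℕ :=
  (Finset.range (w.length - 1)).filter fun i => w.getD (i + 1) 0 < w.getD i 0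

/-- The number of descents of a permutation. -/
def descentCount {n : ℕ} (π : Equiv.Perm (Fin n)) : ℕ :=
  (descentSet (permWord π)).card

/-- A permutation is ballot if every prefix of its one-line notation has at least
as many ascents as descents. -/
def IsBallot {n : ℕ} (π : Equiv.Perm (Fin n)) : Prop :=
  ∀ k, k ≤ n →
    (descentSet ((permWord π).take k)).card ≤ (ascentSet ((permWord π).take k)).card

/-- The Eulerian number `E(n,d)`: the number of permutations of `{1,…,n}` with
exactly `d` descents.  (`E(0,0) = 1` and `E(0,d) = 0` for `d ≥ 1`.) -/
noncomputable def eulerianNum (n d : ℕ) : ℕ :=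
  (Finset.univ.filter fun π : Equiv.Perm (Fin n) => descentCount π = d).card

/-- `M(c)` for a cycle `c`: the minimum of the number of cyclic ascents and the
number of cyclic descents of `c`. -/
noncomputable def cycleM {n : ℕ} (c : Equiv.Perm (Fin n)) : ℕ :=
  min ((c.support.filter fun x => x < c x).card) ((c.support.filter fun x => c x < x).card)

/-- `M(π)`: the sum of `M(c)` over the cycles `c` of the cycle decomposition of `π`
(fixed points contribute `0`). -/
noncomputable def permM {n : ℕ} (π : Equiv.Perm (Fin n)) : ℕ :=
  ∑ c ∈ π.cycleFactorsFinset, cycleM c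

/-- The number of ballot permutations of `{1,…,n}`. -/
noncomputable def ballotTotal (n : ℕ) : ℕ :=
  (Finset.univ.filter fun π : Equiv.Perm (Fin n) => IsBallot π).card

/-- The number of permutations of `{1,…,n}` of odd order. -/
noncomputable def oddOrderTotal (n : ℕ) : ℕ :=
  (Finset.univ.filter fun π : Equiv.Perm (Fin n) => Odd (orderOf π)).card

/-- `b(n,d)`: the number of ballot permutations of `{1,…,n}` with exactly `d` descents. -/
noncomputable def bCount (n d : ℕ) : ℕ :=
  (Finset.univ.filter fun π : Equiv.Perm (Fin n) => IsBallot π ∧ descentCount π = d).card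

/-- `p(n,d)`: the number of odd order permutations `π` of `{1,…,n}` with `M(π) = d`. -/
noncomputable def pCount (n d : ℕ) : ℕ :=
  (Finset.univ.filter fun π : Equiv.Perm (Fin n) => Odd (orderOf π) ∧ permM π = d).card

/-- The Eulerian–Catalan numbers: `EC(n) = 2·E(2n, n-1)`, with `EC(0) = 1`. -/
noncomputable def eulerianCatalan (n : ℕ) : ℕ :=
  if n = 0 then 1 else 2 * eulerianNum (2 * n) (n - 1)

namespace OddOrder

open Equiv Equiv.Perm

/-- The number of strict excedances of a permutation of a finite linear order. -/
def ups {β : Type*} [Fintype β] [LinearOrder β] (g : Perm β) : ℕ :=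
  #{x | x < g x}

/-- The number of strict anti-excedances of a permutation of a finite linear order. -/
def downs {β : Type*} [Fintype β] [LinearOrder β] (g : Perm β) : ℕ :=
  #{x | g x < x}

/-- A permutation with a single orbit. -/
def IsFull {β : Type*} (g : Perm β) : Prop := ∀ x y, g.SameCycle x y

lemma isFull_inv {β : Type*} {g : Perm β} : IsFull g⁻¹ ↔ IsFull g := by
  simp only [IsFull, sameCycle_inv]

lemma downs_inv {β : Type*} [Fintype β] [LinearOrder β] (g : Perm β) : downs g⁻¹ = ups g := by
  unfold downs ups
  refine Finset.card_bij' (fun x _ => g⁻¹ x) (fun x _ => g x) ?_ ?_ ?_ ?_ <;> simp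

lemma IsFull.apply_ne {β : Type*} [Nontrivial β] {g : Perm β} (h : IsFull g) (x : β) :
    g x ≠ x := by
  intro hx
  obtain ⟨y, hy⟩ := exists_ne x
  exact hy ((h x y).eq_of_left hx).symm

lemma ups_add_downs {β : Type*} [Fintype β] [LinearOrder β] [Nontrivial β] {g : Perm β}
    (h : IsFull g) : ups g + downs g = Fintype.card β := by
  have h1 : downs g = #{x | ¬ x < g x} := by
    unfold downs
    congr 1
    ext x
    have := h.apply_ne x
    simp only [mem_filter, mem_univ, true_and, not_lt]
    exact ⟨le_of_lt, fun h' => lt_of_le_of_ne h' this⟩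
  rw [h1, ups, Finset.card_filter_add_card_filter_not, Finset.card_univ]

lemma isFull_conj {β γ : Type*} (e : β ≃ γ) (g : Perm β) : IsFull (e.permCongr g) ↔ IsFull g := by
  have key : ∀ (k : ℤ) (y : γ), ((e.permCongr g) ^ k) y = e ((g ^ k) (e.symm y)) := by
    intro k y
    have : (e.permCongr g) ^ k = e.permCongr (g ^ k) := (map_zpow e.permCongrHom g k).symm
    rw [this, Equiv.permCongr_apply]
  constructor
  · intro h x y
    obtain ⟨k, hk⟩ := h (e x) (e y)
    exact ⟨k, by simpa [key] using hk⟩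
  · intro h x y
    obtain ⟨k, hk⟩ := h (e.symm x) (e.symm y)
    exact ⟨k, by simp [key, hk]⟩

lemma card_full_congr {β γ : Type*} [Fintype β] [LinearOrder β] [Fintype γ] [LinearOrder γ]
    (e : β ≃o γ) (P : ℕ → ℕ → Prop) [∀ a b, Decidable (P a b)] :
    #{g : Perm β | IsFull g ∧ P (ups g) (downs g)} =
      #{g : Perm γ | IsFull g ∧ P (ups g) (downs g)} := by
  have hu : ∀ g : Perm β, ups (e.toEquiv.permCongr g) = ups g := fun g => by
    refine Finset.card_bij' (fun x _ => e.symm x) (fun x _ => e x) ?_ ?_ ?_ ?_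
    · exact fun x hx => mem_filter.2 ⟨mem_univ _, e.symm_apply_lt.2 (mem_filter.1 hx).2⟩
    · refine fun x hx => mem_filter.2 ⟨mem_univ _, ?_⟩
      simpa using (mem_filter.1 hx).2
    · simp
    · simp
  have hd : ∀ g : Perm β, downs (e.toEquiv.permCongr g) = downs g := fun g => by
    refine Finset.card_bij' (fun x _ => e.symm x) (fun x _ => e x) ?_ ?_ ?_ ?_ <;>
      simp [← e.lt_symm_apply]
  refine Finset.card_bij (fun g _ => e.toEquiv.permCongr g) ?_ ?_ ?_
  · intro g hg
    simpa [isFull_conj, hu, hd] using hg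
  · intro g _ g' _ h
    exact e.toEquiv.permCongr.injective h
  · intro g hg
    obtain ⟨g, rfl⟩ := e.toEquiv.permCongr.surjective g
    exact ⟨g, by simpa [isFull_conj, hu, hd] using hg, rfl⟩

lemma isFull_finRotate (m : ℕ) : IsFull (finRotate (m + 2)) := by
  have h : ∀ x, finRotate (m + 2) x ≠ x := fun x => by
    rw [← mem_support, support_finRotate]; exact mem_univ x
  exact fun x y => isCycle_finRotate.sameCycle (h x) (h y)

lemma descentCount_eq (m : ℕ) (σ : Perm (Fin (m + 1))) :
    descentCount σ = ∑ i : Fin m, if σ i.succ < σ i.castSucc then 1 else 0 := by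
  unfold descentCount descentSet
  rw [Finset.card_filter]
  have : (permWord σ).length - 1 = m := by simp [permWord]
  rw [this, Finset.sum_range]
  refine Finset.sum_congr rfl fun i _ => ?_
  have h1 : (permWord σ).getD i 0 = (σ i.castSucc : ℕ) + 1 := by
    rw [List.getD_eq_getElem _ _ (by simp [permWord])]
    simp [permWord]
    rfl
  have h2 : (permWord σ).getD (i + 1) 0 = (σ i.succ : ℕ) + 1 := by
    rw [List.getD_eq_getElem _ _ (by simp [permWord])]
    simp [permWord]
    rfl
  rw [h1, h2]
  simp only [add_lt_add_iff_right, Fin.val_fin_lt]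

/-- The full cycle `(0, σ 0 + 1, σ 1 + 1, …)`. -/
def toCycle (m : ℕ) (σ : Perm (Fin (m + 1))) : Perm (Fin (m + 2)) :=
  decomposeFin.symm (0, σ) * finRotate (m + 2) * (decomposeFin.symm (0, σ))⁻¹

lemma downs_toCycle (m : ℕ) (σ : Perm (Fin (m + 1))) :
    downs (toCycle m σ) = descentCount σ + 1 := by
  set ρ := decomposeFin.symm ((0 : Fin (m + 2)), σ) with hρ
  have h0 : ρ 0 = 0 := by simp [hρ]
  have hs : ∀ i, ρ i.succ = (σ i).succ := fun i => by simp [hρ]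
  have h1 : downs (toCycle m σ) = #{j | ρ (finRotate (m + 2) j) < ρ j} := by
    refine Finset.card_bij' (fun x _ => ρ⁻¹ x) (fun x _ => ρ x) ?_ ?_ ?_ ?_ <;>
      simp [toCycle, ← hρ]
  rw [h1, Finset.card_filter, Fin.sum_univ_succ, Fin.sum_univ_castSucc, descentCount_eq]
  have ha : ∀ i : Fin m, finRotate (m + 2) i.castSucc.succ = i.succ.succ := fun i => by
    rw [finRotate_apply]
    ext
    simp [Fin.val_add_one, Fin.ext_iff]
    omega
  have hl : finRotate (m + 2) (Fin.last m).succ = 0 := by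
    simp [Fin.succ_last]
  have hz : (0 : Fin (m + 2)) < ρ (Fin.last m).succ := by simp only [hs, Fin.succ_pos]
  simp only [h0, hs, ha, hl] at hz ⊢
  simp [hz]

lemma isFull_toCycle (m : ℕ) (σ : Perm (Fin (m + 1))) : IsFull (toCycle m σ) := by
  intro x y
  rw [toCycle, sameCycle_conj]
  exact isFull_finRotate m _ _

lemma conj_pow_eq {β : Type*} {ρ c g : Perm β} (h : ρ * c * ρ⁻¹ = g) (k : ℤ) (x : β) :
    ρ ((c ^ k) x) = (g ^ k) (ρ x) := by
  rw [← h, conj_zpow]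
  simp

lemma toCycle_injective (m : ℕ) : Function.Injective (toCycle m) := by
  intro σ τ h
  have : decomposeFin.symm ((0 : Fin (m + 2)), σ) = decomposeFin.symm (0, τ) := by
    ext1 x
    obtain ⟨k, rfl⟩ := isFull_finRotate m 0 x
    rw [conj_pow_eq (g := toCycle m σ) rfl, conj_pow_eq (g := toCycle m τ) rfl, h]
    simp
  simpa using this

lemma toCycle_surjective (m : ℕ) {g : Perm (Fin (m + 2))} (hg : IsFull g) :
    ∃ σ, toCycle m σ = g := by
  have hc : g.IsCycle := ⟨0, hg.apply_ne 0, fun y _ => hg 0 y⟩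
  have hsupp : g.support = univ := by
    ext x; simpa using hg.apply_ne x
  obtain ⟨τ, hτ⟩ := isConj_iff.1 ((isCycle_finRotate (n := m)).isConj hc
    (by rw [hsupp, support_finRotate]))
  obtain ⟨k, hk⟩ := isFull_finRotate m 0 (τ⁻¹ 0)
  set ρ := τ * finRotate (m + 2) ^ k with hρ
  have hρ0 : ρ 0 = 0 := by simp [hρ, hk]
  have hρg : ρ * finRotate (m + 2) * ρ⁻¹ = g := by
    rw [← hτ, hρ]; group
  obtain ⟨⟨p, σ⟩, hσ⟩ := decomposeFin.symm.surjective ρ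
  have hp : p = 0 := by
    rw [← hσ] at hρ0
    simpa using hρ0
  subst hp
  exact ⟨σ, by rw [toCycle, hσ, hρg]⟩

lemma card_full_downs (m d : ℕ) :
    #{g : Perm (Fin (m + 2)) | IsFull g ∧ downs g = d + 1} = eulerianNum (m + 1) d := by
  symm
  refine Finset.card_bij (fun σ _ => toCycle m σ) ?_ ?_ ?_
  · intro σ hσ
    simpa [isFull_toCycle, downs_toCycle] using hσ
  · intro σ _ τ _ h
    exact toCycle_injective m h
  · intro g hg
    rw [mem_filter] at hg
    replace hg := hg.2
    obtain ⟨σ, rfl⟩ := toCycle_surjective m hg.1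
    exact ⟨σ, by simpa [downs_toCycle] using hg.2, rfl⟩

lemma card_full_ups (m d : ℕ) :
    #{g : Perm (Fin (m + 2)) | IsFull g ∧ ups g = d + 1} = eulerianNum (m + 1) d := by
  rw [← card_full_downs]
  refine Finset.card_bij' (fun g _ => g⁻¹) (fun g _ => g⁻¹) ?_ ?_ ?_ ?_
  · intro g; simp [isFull_inv, downs_inv]
  · intro g; simp [isFull_inv, ← downs_inv g⁻¹]
  · simp
  · simp

lemma card_full_min (m d : ℕ) (h : 2 * (d + 1) < m + 2) :
    #{g : Perm (Fin (m + 2)) | IsFull g ∧ min (ups g) (downs g) = d + 1} =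
      2 * eulerianNum (m + 1) d := by
  have :
      (univ.filter fun g : Perm (Fin (m + 2)) => IsFull g ∧ min (ups g) (downs g) = d + 1) =
        (univ.filter fun g => IsFull g ∧ ups g = d + 1) ∪
          univ.filter fun g => IsFull g ∧ downs g = d + 1 := by
    ext g
    simp only [mem_filter, mem_univ, true_and, mem_union, ← and_or_left]
    refine and_congr_right fun hg => ?_
    have := ups_add_downs hg
    rw [Fintype.card_fin] at this
    omega
  rw [this, Finset.card_union_of_disjoint, card_full_ups, card_full_downs]
  · ring
  · rw [Finset.disjoint_filter]
    rintro g _ ⟨hg, h1⟩ ⟨_, h2⟩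
    have := ups_add_downs hg
    rw [Fintype.card_fin] at this
    omega

lemma card_full_max {β : Type*} [Fintype β] [LinearOrder β] (h : Odd (Fintype.card β)) :
    #{g : Perm β | IsFull g ∧ min (ups g) (downs g) = (Fintype.card β - 1) / 2} =
      eulerianCatalan ((Fintype.card β - 1) / 2) := by
  obtain ⟨m, hm⟩ := h
  have e : β ≃o Fin (2 * m + 1) := (monoEquivOfFin β hm).symm
  rw [card_full_congr e (fun a b => min a b = (Fintype.card β - 1) / 2), hm]
  have h2 : (2 * m + 1 - 1) / 2 = m := by omega
  rw [h2]
  rcases m with _ | m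
  · simp only [eulerianCatalan, if_true]
    simp [Finset.filter_eq_self.2, IsFull, ups, downs, Subsingleton.elim _ (0 : Fin 1)]
  · rw [eulerianCatalan, if_neg (by omega)]
    exact card_full_min (2 * m + 1) m (by omega)

/-- The map `f` labels the orbits of `π`. -/
def IsLabel {α ι : Type*} (π : Perm α) (f : α → ι) : Prop :=
  ∀ x y, π.SameCycle x y ↔ f x = f y

section Glue

variable {α ι : Type*}

/-- Assemble a permutation from permutations of the fibers of `f`. -/
def glue (f : α → ι) : (∀ i, Perm {x // f x = i}) →* Perm α :=
  (sigmaFiberEquiv f).permCongrHom.toMonoidHom.comp (sigmaCongrRightHom _)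

lemma glue_apply (f : α → ι) (g : ∀ i, Perm {x // f x = i}) (i : ι) (x : {x // f x = i}) :
    glue f g x = g i x := by
  obtain ⟨x, rfl⟩ := x
  rfl

lemma glue_zpow_apply (f : α → ι) (g : ∀ i, Perm {x // f x = i}) (i : ι) (x : {x // f x = i})
    (k : ℤ) : (glue f g ^ k) x = ((g i) ^ k) x := by
  rw [← map_zpow, glue_apply, Pi.pow_apply]

lemma glue_injective (f : α → ι) : Function.Injective (glue f) := by
  intro g h hgh
  ext i x
  rw [← glue_apply, ← glue_apply, hgh]

lemma isLabel_glue (f : α → ι) (g : ∀ i, Perm {x // f x = i}) :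
    IsLabel (glue f g) f ↔ ∀ i, IsFull (g i) := by
  constructor
  · intro h i x y
    obtain ⟨k, hk⟩ := (h x y).2 (x.2.trans y.2.symm)
    exact ⟨k, Subtype.ext (by rw [← glue_zpow_apply, hk])⟩
  · intro h x y
    constructor
    · rintro ⟨k, rfl⟩
      have := glue_zpow_apply f g (f x) ⟨x, rfl⟩ k
      simp only at this
      rw [this]
      exact ((g (f x) ^ k) ⟨x, rfl⟩).2.symm
    · intro hxy
      obtain ⟨k, hk⟩ := h (f x) ⟨x, rfl⟩ ⟨y, hxy.symm⟩
      refine ⟨k, ?_⟩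
      have := glue_zpow_apply f g (f x) ⟨x, rfl⟩ k
      simp only at this
      rw [this, hk]

lemma IsLabel.exists_glue {f : α → ι} {π : Perm α} (h : IsLabel π f) : ∃ g, glue f g = π := by
  have hf : ∀ x, f (π x) = f x := fun x => ((h x (π x)).1 ⟨1, by simp⟩).symm
  refine ⟨fun i => π.subtypePerm (p := fun x => f x = i) fun x => by rw [hf], ?_⟩
  ext x
  exact glue_apply f _ (f x) ⟨x, rfl⟩

variable [Fintype α] [DecidableEq ι]

lemma card_fiber_glue (f : α → ι) (g : ∀ i, Perm {x // f x = i}) (i : ι) (R : α → α → Prop) :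
    #{x | f x = i ∧ R x (glue f g x)} = #{x : {x // f x = i} | R x (g i x)} := by
  symm
  refine Finset.card_bij (fun x _ => x.1) ?_ ?_ ?_
  · intro x hx
    rw [mem_filter] at hx ⊢
    exact ⟨mem_univ _, x.2, by rw [glue_apply]; exact hx.2⟩
  · intro x _ y _ h
    exact Subtype.ext h
  · intro x hx
    obtain ⟨-, rfl, hR⟩ := mem_filter.1 hx
    exact ⟨⟨x, rfl⟩, mem_filter.2 ⟨mem_univ _, hR⟩, rfl⟩

variable [LinearOrder α]

/-- The number of strict excedances in the fiber of `f` over `i`. -/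
def fiberUps (π : Perm α) (f : α → ι) (i : ι) : ℕ := #{x | f x = i ∧ x < π x}

/-- The number of strict anti-excedances in the fiber of `f` over `i`. -/
def fiberDowns (π : Perm α) (f : α → ι) (i : ι) : ℕ := #{x | f x = i ∧ π x < x}

lemma fiberUps_glue (f : α → ι) (g : ∀ i, Perm {x // f x = i}) (i : ι) :
    fiberUps (glue f g) f i = ups (g i) := by
  convert card_fiber_glue f g i (· < ·) using 1
  · unfold fiberUps; congr
  · unfold ups; congr

lemma fiberDowns_glue (f : α → ι) (g : ∀ i, Perm {x // f x = i}) (i : ι) :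
    fiberDowns (glue f g) f i = downs (g i) := by
  convert card_fiber_glue f g i (· > ·) using 1
  · unfold fiberDowns; congr
  · unfold downs; congr

lemma card_isLabel [Fintype ι] (f : α → ι) (P : ι → ℕ → ℕ → Prop) :
    #{π : Perm α | IsLabel π f ∧ ∀ i, P i (fiberUps π f i) (fiberDowns π f i)} =
      ∏ i, #{g : Perm {x // f x = i} | IsFull g ∧ P i (ups g) (downs g)} := by
  rw [← Fintype.card_piFinset]
  symm
  refine Finset.card_bij (fun g _ => glue f g) ?_ ?_ ?_
  · intro g hg
    simp only [Fintype.mem_piFinset, mem_filter, mem_univ, true_and] at hg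
    rw [mem_filter]
    refine ⟨mem_univ _, (isLabel_glue f g).2 fun i => (hg i).1, fun i => ?_⟩
    rw [fiberUps_glue, fiberDowns_glue]
    exact (hg i).2
  · intro g _ h _ hgh
    exact glue_injective f hgh
  · intro π hπ
    obtain ⟨-, hl, hπ⟩ := mem_filter.1 hπ
    obtain ⟨g, rfl⟩ := hl.exists_glue
    refine ⟨g, ?_, rfl⟩
    simp only [Fintype.mem_piFinset, mem_filter, mem_univ, true_and]
    intro i
    rw [← fiberUps_glue, ← fiberDowns_glue]
    exact ⟨(isLabel_glue f g).1 hl i, hπ i⟩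

lemma fiberUps_add_fiberDowns_le (π : Perm α) (f : α → ι) (i : ι) :
    fiberUps π f i + fiberDowns π f i ≤ #{x | f x = i} := by
  rw [fiberUps, fiberDowns, ← Finset.card_union_of_disjoint]
  · refine Finset.card_le_card fun x hx => ?_
    rcases mem_union.1 hx with h | h <;>
      exact mem_filter.2 ⟨mem_univ _, (mem_filter.1 h).2.1⟩
  · rw [Finset.disjoint_filter]
    rintro x _ ⟨_, h⟩ ⟨_, h'⟩
    exact h.asymm h'

end Glue

section Labels

lemma exists_isLabel {α : Type*} [Fintype α] (π : Perm α) :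
    ∃ (r : ℕ) (f : α → Fin r), Function.Surjective f ∧ IsLabel π f := by
  let s := SameCycle.setoid π
  let e := Fintype.equivFin (Quotient s)
  refine ⟨_, fun x => e (Quotient.mk s x), e.surjective.comp Quotient.mk_surjective, fun x y => ?_⟩
  rw [e.injective.eq_iff, Quotient.eq]
  rfl

lemma card_labels {α : Type*} [Fintype α] [DecidableEq α] {r : ℕ} {π : Perm α} {f : α → Fin r}
    (hs : Function.Surjective f) (hf : IsLabel π f) :
    #{f' : α → Fin r | Function.Surjective f' ∧ IsLabel π f'} = r.factorial := by
  have hcard : r.factorial = #(univ : Finset (Perm (Fin r))) := by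
    rw [Finset.card_univ, Fintype.card_perm, Fintype.card_fin]
  rw [hcard]
  symm
  refine Finset.card_bij (fun e _ => e ∘ f) ?_ ?_ ?_
  · intro e _
    refine mem_filter.2 ⟨mem_univ _, e.surjective.comp hs, fun x y => ?_⟩
    rw [hf x y]
    simp
  · intro e _ e' _ h
    ext1 i
    obtain ⟨x, rfl⟩ := hs i
    exact congrFun h x
  · intro f' hf'
    obtain ⟨-, hs', hl⟩ := mem_filter.1 hf'
    have hfs : ∀ x, f' (Function.surjInv hs (f x)) = f' x := fun x => by
      rw [← hl, hf, Function.surjInv_eq hs]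
    have hinj : Function.Injective fun i => f' (Function.surjInv hs i) := by
      intro i j hij
      have := (hf _ _).1 ((hl _ _).2 hij)
      rwa [Function.surjInv_eq hs, Function.surjInv_eq hs] at this
    refine ⟨Equiv.ofBijective _ (Finite.injective_iff_bijective.1 hinj), mem_univ _, ?_⟩
    funext x
    exact hfs x

variable {N : ℕ} {ι : Type*} [DecidableEq ι] {π : Perm (Fin N)} {f : Fin N → ι}

lemma IsLabel.cycleM_cycleOf (hf : IsLabel π f) (y : Fin N) :
    cycleM (π.cycleOf y) = min (fiberUps π f (f y)) (fiberDowns π f (f y)) := by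
  have key : ∀ x, f x = f y → π.cycleOf y x = π x := fun x hx =>
    ((hf y x).2 hx.symm).cycleOf_apply
  have hsupp : ∀ x, x ∈ (π.cycleOf y).support ↔ f x = f y ∧ π x ≠ x := fun x => by
    rw [mem_support_cycleOf_iff, mem_support, eq_comm (a := f x), ← hf]
    exact and_congr_right fun h => not_congr h.apply_eq_self_iff
  unfold cycleM fiberUps fiberDowns
  congr 2
  · ext x
    simp only [mem_filter, hsupp, mem_univ, true_and]
    constructor
    · rintro ⟨⟨h1, -⟩, h3⟩
      exact ⟨h1, key x h1 ▸ h3⟩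
    · rintro ⟨h1, h2⟩
      exact ⟨⟨h1, h2.ne'⟩, (key x h1).symm ▸ h2⟩
  · ext x
    simp only [mem_filter, hsupp, mem_univ, true_and]
    constructor
    · rintro ⟨⟨h1, -⟩, h3⟩
      exact ⟨h1, key x h1 ▸ h3⟩
    · rintro ⟨h1, h2⟩
      exact ⟨⟨h1, h2.ne⟩, (key x h1).symm ▸ h2⟩

lemma IsLabel.permM_eq [Fintype ι] (hs : Function.Surjective f) (hf : IsLabel π f) :
    permM π = ∑ i, min (fiberUps π f i) (fiberDowns π f i) := by
  set s := Function.surjInv hs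
  have hfs : ∀ i, f (s i) = i := Function.surjInv_eq hs
  have h1 : ∀ i, min (fiberUps π f i) (fiberDowns π f i) = cycleM (π.cycleOf (s i)) := fun i => by
    rw [hf.cycleM_cycleOf, hfs]
  have hne : ∀ y, cycleM (π.cycleOf y) ≠ 0 → y ∈ π.support := by
    intro y hy
    by_contra h
    rw [notMem_support, ← cycleOf_eq_one_iff] at h
    simp [h, cycleM] at hy
  simp only [h1]
  symm
  refine Finset.sum_bij_ne_zero (fun i _ _ => π.cycleOf (s i)) ?_ ?_ ?_ ?_
  · intro i _ hi
    exact cycleOf_mem_cycleFactorsFinset_iff.2 (hne _ hi)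
  · intro i _ hi j _ hj hij
    have h2 : s i ∈ (π.cycleOf (s i)).support := by
      rw [mem_support_cycleOf_iff]
      exact ⟨SameCycle.refl _ _, hne _ hi⟩
    rw [hij, mem_support_cycleOf_iff] at h2
    have := (hf _ _).1 h2.1
    rw [hfs, hfs] at this
    exact this.symm
  · intro c hc hc0
    obtain ⟨x, hx⟩ := (mem_cycleFactorsFinset_iff.1 hc).1.nonempty_support
    have hcx := cycle_is_cycleOf hx hc
    have h3 : π.cycleOf (s (f x)) = c := by
      rw [hcx]
      exact ((hf _ _).2 (hfs _)).cycleOf_eq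
    exact ⟨f x, mem_univ _, by rwa [h3], h3⟩
  · intro i _ _
    rfl

lemma IsLabel.card_fiber (hf : IsLabel π f) (y : Fin N) :
    #{x | f x = f y} = orderOf (π.cycleOf y) := by
  by_cases hy : π y = y
  · rw [(cycleOf_eq_one_iff π).2 hy, orderOf_one, Finset.card_eq_one]
    refine ⟨y, ?_⟩
    ext x
    rw [mem_filter, mem_singleton, eq_comm (a := f x), ← hf]
    constructor
    · rintro ⟨-, h⟩
      exact (h.eq_of_left hy).symm
    · rintro rfl
      exact ⟨mem_univ _, SameCycle.refl _ _⟩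
  · rw [(isCycle_cycleOf π hy).orderOf]
    congr 1
    ext x
    rw [mem_support_cycleOf_iff' hy, mem_filter, eq_comm (a := f x), ← hf]
    exact and_iff_right (mem_univ _)

lemma IsLabel.odd_orderOf_iff [Fintype ι] (hs : Function.Surjective f) (hf : IsLabel π f) :
    Odd (orderOf π) ↔ ∀ i, Odd #{x | f x = i} := by
  constructor
  · intro h i
    obtain ⟨y, rfl⟩ := hs i
    rw [hf.card_fiber]
    exact h.of_dvd_nat (orderOf_cycleOf_dvd_orderOf π y)
  · intro h
    have h1 : Odd (∏ i, #{x | f x = i}) :=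
      Finset.prod_induction _ Odd (fun _ _ => Odd.mul) odd_one fun i _ => h i
    refine h1.of_dvd_nat (orderOf_dvd_of_pow_eq_one ?_)
    ext1 y
    have h2 : π.cycleOf y ^ (∏ i, #{x | f x = i}) = 1 := by
      rw [← orderOf_dvd_iff_pow_eq_one, ← hf.card_fiber]
      exact Finset.dvd_prod_of_mem _ (mem_univ _)
    rw [← cycleOf_pow_apply_self, h2]

end Labels

lemma sum_three_fibers {α : Type*} [Fintype α] [DecidableEq α] (W : ℕ → ℕ) :
    ∑ f : α → Fin 3, ∏ i, W #{x | f x = i} =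
      ∑ k ∈ range (Fintype.card α + 1), (Fintype.card α).choose k *
        ∑ l ∈ range (Fintype.card α - k + 1), (Fintype.card α - k).choose l *
          (W k * W l * W (Fintype.card α - k - l)) := by
  have h1 : ∀ A : Finset α, ∑ B ∈ Aᶜ.powerset, W #A * W #B * W (Fintype.card α - #A - #B) =
      ∑ l ∈ range (Fintype.card α - #A + 1), (Fintype.card α - #A).choose l *
          (W #A * W l * W (Fintype.card α - #A - l)) := fun A => by
    rw [Finset.sum_powerset_apply_card (fun l => W #A * W l * W (Fintype.card α - #A - l)),
      Finset.card_compl]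
    simp
  have h2 := Finset.sum_powerset_apply_card (x := (univ : Finset α)) (fun k =>
      ∑ l ∈ range (Fintype.card α - k + 1), (Fintype.card α - k).choose l *
          (W k * W l * W (Fintype.card α - k - l)))
  simp only [← h1, Finset.card_univ, smul_eq_mul] at h2
  rw [← h2, Finset.sum_sigma']
  refine Finset.sum_bij' (fun f _ => ⟨univ.filter (f · = 0), univ.filter (f · = 1)⟩)
    (fun p _ x => if x ∈ p.1 then 0 else if x ∈ p.2 then 1 else 2) ?_ ?_ ?_ ?_ ?_
  · intro f _
    simp only [mem_sigma, mem_powerset, subset_univ, true_and]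
    intro x hx
    simp only [mem_filter, mem_univ, true_and, mem_compl] at hx ⊢
    simp [hx]
  · simp
  · intro f _
    funext x
    have : ∀ j : Fin 3, (if j = 0 then 0 else if j = 1 then 1 else 2) = j := by decide
    simpa using this (f x)
  · rintro ⟨A, B⟩ h
    simp only [mem_sigma, mem_powerset, subset_univ, true_and] at h
    have h' : ∀ x ∈ B, x ∉ A := fun x hx => by simpa using h hx
    congr 1
    · ext x
      by_cases hA : x ∈ A <;> by_cases hB : x ∈ B <;> simp [hA, hB]
    · ext x
      have := h' x
      by_cases hA : x ∈ A <;> by_cases hB : x ∈ B <;> simp_all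
  · intro f _
    have hsum : #{x | f x = 0} + #{x | f x = 1} + #{x | f x = 2} = Fintype.card α := by
      have := Finset.card_eq_sum_card_fiberwise (f := f) (s := univ) (t := univ) (by simp)
      rw [Fin.sum_univ_three, Finset.card_univ] at this
      exact this.symm
    rw [Fin.prod_univ_three]
    congr 2
    simp only
    omega

/-- The number of cycles on `k` letters, `k` odd, with the largest possible value of `M`. -/
noncomputable def maxCycleCount (k : ℕ) : ℕ := if Odd k then eulerianCatalan ((k - 1) / 2) else 0

/-- The map `f` labels the orbits of `π`, each of odd size and with the largest possible `M`. -/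
def IsMaxLabel {α ι : Type*} [Fintype α] [LinearOrder α] [DecidableEq ι] (π : Perm α)
    (f : α → ι) : Prop :=
  IsLabel π f ∧ ∀ i, Odd #{x | f x = i} ∧
    min (fiberUps π f i) (fiberDowns π f i) = (#{x | f x = i} - 1) / 2

lemma card_isMaxLabel {α ι : Type*} [Fintype α] [LinearOrder α] [Fintype ι] [DecidableEq ι]
    (f : α → ι) : #{π : Perm α | IsMaxLabel π f} = ∏ i, maxCycleCount #{x | f x = i} := by
  have h := card_isLabel f
    (fun i a b => Odd #{x | f x = i} ∧ min a b = (#{x | f x = i} - 1) / 2)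
  refine Eq.trans ?_ (h.trans ?_)
  · unfold IsMaxLabel
    congr
  refine Finset.prod_congr rfl fun i _ => ?_
  have hc : Fintype.card {x // f x = i} = #{x | f x = i} := Fintype.card_subtype _
  by_cases ho : Odd #{x | f x = i}
  · rw [maxCycleCount, if_pos ho, ← hc, ← card_full_max (hc ▸ ho)]
    congr 1
    ext g
    simp [hc, ho]
  · simp [maxCycleCount, ho]

lemma odd_label_count {n r : ℕ} {f : Fin (2 * n + 1) → Fin r}
    (ho : ∀ i, Odd #{x | f x = i}) :
    ∑ i, (#{x | f x = i} - 1) / 2 = (2 * n + 1 - r) / 2 ∧ Odd r ∧ r ≤ 2 * n + 1 := by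
  have hsum : ∑ i, #{x | f x = i} = 2 * n + 1 := by
    have := Finset.card_eq_sum_card_fiberwise (f := f) (s := univ) (t := univ) (by simp)
    rw [Finset.card_univ, Fintype.card_fin] at this
    exact this.symm
  have h2 : ∑ i, #{x | f x = i} = 2 * (∑ i, (#{x | f x = i} - 1) / 2) + r := by
    rw [Finset.mul_sum]
    calc _ = ∑ i : Fin r, (2 * ((#{x | f x = i} - 1) / 2) + 1) := by
          refine Finset.sum_congr rfl fun i _ => ?_
          obtain ⟨k, hk⟩ := ho i
          omega
      _ = _ := by rw [Finset.sum_add_distrib]; simp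
  rw [hsum] at h2
  refine ⟨by omega, ?_, by omega⟩
  rw [Nat.odd_iff]
  omega

lemma isMaxLabel_iff {n : ℕ} (hn : 1 ≤ n) {π : Perm (Fin (2 * n + 1))}
    {f : Fin (2 * n + 1) → Fin 3} (hs : Function.Surjective f) (hf : IsLabel π f) :
    IsMaxLabel π f ↔ Odd (orderOf π) ∧ permM π = n - 1 := by
  rw [hf.odd_orderOf_iff hs, hf.permM_eq hs, IsMaxLabel, and_iff_right hf, forall_and]
  refine and_congr_right fun ho => ?_
  have h1 := (odd_label_count ho).1
  have h2 : (2 * n + 1 - 3) / 2 = n - 1 := by omega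
  rw [h2] at h1
  have hle : ∀ i ∈ univ, min (fiberUps π f i) (fiberDowns π f i) ≤ (#{x | f x = i} - 1) / 2 := by
    intro i _
    obtain ⟨k, hk⟩ := ho i
    have := fiberUps_add_fiberDowns_le π f i
    omega
  rw [← h1, Finset.sum_eq_sum_iff_of_le hle]
  simp

lemma label_count_eq {n r : ℕ} (hn : 1 ≤ n) {π : Perm (Fin (2 * n + 1))}
    {f : Fin (2 * n + 1) → Fin r} (hs : Function.Surjective f) (hf : IsLabel π f)
    (ho : Odd (orderOf π)) (hM : permM π = n - 1) : r = 1 ∨ r = 3 := by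
  rw [hf.odd_orderOf_iff hs] at ho
  rw [hf.permM_eq hs] at hM
  obtain ⟨h1, h2, h3⟩ := odd_label_count ho
  have hle : ∑ i, min (fiberUps π f i) (fiberDowns π f i) ≤ ∑ i, (#{x | f x = i} - 1) / 2 := by
    refine Finset.sum_le_sum fun i _ => ?_
    obtain ⟨k, hk⟩ := ho i
    have := fiberUps_add_fiberDowns_le π f i
    omega
  obtain ⟨k, hk⟩ := h2
  omega

lemma IsLabel.isFull {α : Type*} {π : Perm α} {f : α → Fin 1} (hf : IsLabel π f) : IsFull π :=
  fun x y => (hf x y).2 (Subsingleton.elim _ _)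

lemma IsFull.odd_and_permM_iff {n d : ℕ} {π : Perm (Fin (2 * n + 1))} (h : IsFull π) :
    (Odd (orderOf π) ∧ permM π = d) ↔ min (ups π) (downs π) = d := by
  have hf : IsLabel π (fun _ => (0 : Fin 1)) := fun x y => iff_of_true (h x y) rfl
  have hs : Function.Surjective (fun _ : Fin (2 * n + 1) => (0 : Fin 1)) :=
    fun i => ⟨0, Subsingleton.elim _ _⟩
  rw [hf.odd_orderOf_iff hs, hf.permM_eq hs]
  simp [fiberUps, fiberDowns, ups, downs]

lemma pCount_eq {n : ℕ} (hn : 2 ≤ n) :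
    pCount (2 * n + 1) (n - 1) = 2 * eulerianNum (2 * n) (n - 2) +
      #{π : Perm (Fin (2 * n + 1)) | (Odd (orderOf π) ∧ permM π = n - 1) ∧
        ∃ f : Fin (2 * n + 1) → Fin 3, Function.Surjective f ∧ IsLabel π f} := by
  have h1 : 2 * eulerianNum (2 * n) (n - 2) =
      #{π : Perm (Fin (2 * n + 1)) | (Odd (orderOf π) ∧ permM π = n - 1) ∧ IsFull π} := by
    obtain ⟨m, rfl⟩ := Nat.exists_eq_add_of_le' hn
    refine (card_full_min (2 * m + 3) m (by omega)).symm.trans ?_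
    congr 1
    ext π
    rw [mem_filter, mem_filter]
    refine and_congr_right fun _ => ?_
    rw [and_comm]
    refine and_congr_left fun h => ?_
    exact (IsFull.odd_and_permM_iff (n := m + 2) h).symm
  rw [h1, pCount, ← Finset.card_union_of_disjoint]
  · congr 1
    ext π
    simp only [mem_filter, mem_univ, true_and, mem_union, ← and_or_left]
    refine (and_iff_left_of_imp ?_).symm
    rintro ⟨ho, hM⟩
    obtain ⟨r, f, hs, hf⟩ := exists_isLabel π
    rcases label_count_eq (by omega) hs hf ho hM with rfl | rfl
    · exact Or.inl hf.isFull
    · exact Or.inr ⟨f, hs, hf⟩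
  · rw [Finset.disjoint_filter]
    rintro π _ ⟨-, h⟩ ⟨-, f, hs, hf⟩
    obtain ⟨x, hx⟩ := hs 0
    obtain ⟨y, hy⟩ := hs 1
    have := (hf x y).1 (h x y)
    rw [hx, hy] at this
    exact absurd this (by decide)

lemma six_mul_card {n : ℕ} (hn : 2 ≤ n) :
    6 * #{π : Perm (Fin (2 * n + 1)) | (Odd (orderOf π) ∧ permM π = n - 1) ∧
        ∃ f : Fin (2 * n + 1) → Fin 3, Function.Surjective f ∧ IsLabel π f} =
      ∑ f : Fin (2 * n + 1) → Fin 3, ∏ i, maxCycleCount #{x | f x = i} := by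
  simp only [← card_isMaxLabel]
  have hsurj : ∀ (π : Perm (Fin (2 * n + 1))) (f : Fin (2 * n + 1) → Fin 3), IsMaxLabel π f →
      Function.Surjective f := by
    intro π f h i
    obtain ⟨x, hx⟩ := Finset.card_pos.1 (h.2 i).1.pos
    exact ⟨x, (mem_filter.1 hx).2⟩
  simp only [Finset.card_filter]
  rw [Finset.sum_comm, Finset.mul_sum]
  refine Finset.sum_congr rfl fun π _ => ?_
  rw [← Finset.card_filter]
  split_ifs with h
  · obtain ⟨hA, f, hs, hf⟩ := h
    rw [mul_one, ← show Nat.factorial 3 = 6 from rfl, ← card_labels hs hf]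
    congr 1
    ext f'
    simp only [mem_filter, mem_univ, true_and]
    constructor
    · rintro ⟨hs', hf'⟩
      exact (isMaxLabel_iff (by omega) hs' hf').2 hA
    · intro h'
      exact ⟨hsurj π f' h', h'.1⟩
  · rw [mul_zero, eq_comm, Finset.card_eq_zero, Finset.filter_eq_empty_iff]
    intro f _ h'
    have hs := hsurj π f h'
    exact h ⟨(isMaxLabel_iff (by omega) hs h'.1).1 h', f, hs, h'.1⟩

lemma sum_maxCycleCount (n : ℕ) :
    ∑ f : Fin (2 * n + 1) → Fin 3, ∏ i, maxCycleCount #{x | f x = i} =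
      ∑ k ∈ (range (2 * n)).filter (fun k => Odd k),
        ∑ l ∈ (range (2 * n + 2 - k)).filter (fun l => Odd l),
          (2 * n + 1).choose k * (2 * n + 1 - k).choose l * eulerianCatalan ((k - 1) / 2) *
            eulerianCatalan ((l - 1) / 2) * eulerianCatalan ((2 * n - k - l) / 2) := by
  rw [sum_three_fibers, Fintype.card_fin, Finset.sum_range_succ, Finset.sum_range_succ,
    Finset.sum_filter]
  have ha : maxCycleCount (2 * n) = 0 := by simp [maxCycleCount]
  have hb : maxCycleCount 0 = 0 := by simp [maxCycleCount]
  simp only [ha, hb, zero_mul, mul_zero, Finset.sum_const_zero, add_zero, Nat.sub_self, zero_add,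
    Finset.sum_range_one]
  refine Finset.sum_congr rfl fun k hk => ?_
  rw [mem_range] at hk
  split_ifs with hko
  · rw [Finset.mul_sum, Finset.sum_filter, show 2 * n + 1 - k + 1 = 2 * n + 2 - k by omega]
    refine Finset.sum_congr rfl fun l hl => ?_
    rw [mem_range] at hl
    split_ifs with hlo
    · have hm : Odd (2 * n + 1 - k - l) := by
        rw [Nat.odd_iff] at *
        omega
      rw [maxCycleCount, maxCycleCount, maxCycleCount, if_pos hko, if_pos hlo, if_pos hm,
        show 2 * n + 1 - k - l - 1 = 2 * n - k - l by omega]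
      ring
    · simp [maxCycleCount, hlo]
  · simp [maxCycleCount, hko]

end OddOrder

theorem odd_order_second_largest (n : ℕ) (hn : 2 ≤ n) :
    (pCount (2 * n + 1) (n - 1) : ℚ) =
      2 * eulerianNum (2 * n) (n - 2) +
        (1 / 6) * ∑ k ∈ (Finset.range (2 * n)).filter (fun k => Odd k),
          ∑ l ∈ (Finset.range (2 * n + 2 - k)).filter (fun l => Odd l),
            ((2 * n + 1).choose k : ℚ) * ((2 * n + 1 - k).choose l : ℚ) *
              eulerianCatalan ((k - 1) / 2) * eulerianCatalan ((l - 1) / 2) *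
                eulerianCatalan ((2 * n - k - l) / 2) := by
  have h := OddOrder.six_mul_card hn
  rw [OddOrder.sum_maxCycleCount] at h
  rw [OddOrder.pCount_eq hn]
  have h' := congrArg (Nat.cast (R := ℚ)) h
  push_cast at h' ⊢
  rw [← h']
  ring
end

section
/- Let c(n,d) denote the number of n-cycles π in S_n with M(π) = d. Then c(1,0) = 1, and for all odd n ≥ 3: c(n,d) = 0 if d > (n−1)/2, and c(n,d) = 2·E(n−1, d−1) if 1 ≤ d ≤ (n−1)/2. -/
open Finset
open scoped Classical

/-- `c(n,d)`: the number of `n`-cycles `π` of the symmetric group on `{1,…,n}`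
with `M(π) = d`. -/
noncomputable def cycCount (n d : ℕ) : ℕ :=
  (Finset.univ.filter fun π : Equiv.Perm (Fin n) =>
    π.IsCycleOn (Set.univ : Set (Fin n)) ∧ permM π = d).card

/-- The cycle `(0, σ 0 + 1, …, σ (m - 1) + 1)` of `Fin (m + 1)`. -/
def cycleOfWord {m : ℕ} (σ : Equiv.Perm (Fin m)) : Equiv.Perm (Fin (m + 1)) :=
  Equiv.Perm.decomposeFin.symm (0, σ) * finRotate (m + 1) *
    (Equiv.Perm.decomposeFin.symm (0, σ))⁻¹

theorem decomposeFin_symm_zero_succ {m : ℕ} (σ : Equiv.Perm (Fin m)) (i : Fin m) :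
    Equiv.Perm.decomposeFin.symm (0, σ) i.succ = (σ i).succ := by
  simp

theorem cycleOfWord_apply {m : ℕ} (σ : Equiv.Perm (Fin m)) (i : Fin (m + 1)) :
    cycleOfWord σ (Equiv.Perm.decomposeFin.symm (0, σ) i) =
      Equiv.Perm.decomposeFin.symm (0, σ) (finRotate (m + 1) i) := by
  simp [cycleOfWord]

theorem isCycleOn_finRotate (m : ℕ) :
    (finRotate (m + 1)).IsCycleOn (Set.univ : Set (Fin (m + 1))) := by
  cases m with
  | zero => exact ⟨by simp, fun x _ y _ => ⟨0, Subsingleton.elim (α := Fin 1) _ _⟩⟩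
  | succ k =>
    have h := (isCycle_finRotate (n := k)).isCycleOn
    have hs : {x | finRotate (k + 2) x ≠ x} = Set.univ := by
      ext x
      simp
    rwa [hs] at h

theorem isCycleOn_cycleOfWord {m : ℕ} (σ : Equiv.Perm (Fin m)) :
    (cycleOfWord σ).IsCycleOn (Set.univ : Set (Fin (m + 1))) := by
  have h := (isCycleOn_finRotate m).conj (g := Equiv.Perm.decomposeFin.symm (0, σ))
  simpa [cycleOfWord] using h

theorem cycleOfWord_injective {m : ℕ} : Function.Injective (cycleOfWord (m := m)) := by
  intro σ τ h
  have key : ∀ i : Fin (m + 1), Equiv.Perm.decomposeFin.symm (0, σ) i =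
      Equiv.Perm.decomposeFin.symm (0, τ) i := by
    intro i
    induction i using Fin.induction with
    | zero => simp
    | succ i ih =>
      have hr : finRotate (m + 1) i.castSucc = i.succ := by simp
      rw [← hr, ← cycleOfWord_apply, ← cycleOfWord_apply, ih, h]
  have := Equiv.Perm.decomposeFin.symm.injective (Equiv.ext key)
  exact (Prod.ext_iff.mp this).2

theorem isCycle_of_isCycleOn_univ {k : ℕ} {c : Equiv.Perm (Fin (k + 2))}
    (hc : c.IsCycleOn (Set.univ : Set (Fin (k + 2)))) : c.IsCycle ∧ c.support = univ := by
  have hne : ∀ x, c x ≠ x := fun x => hc.apply_ne Set.nontrivial_univ (Set.mem_univ x)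
  refine ⟨⟨0, hne 0, fun y _ => hc.2 (Set.mem_univ _) (Set.mem_univ _)⟩, ?_⟩
  ext x
  simp [hne x]

theorem exists_cycleOfWord_eq {k : ℕ} {c : Equiv.Perm (Fin (k + 2))}
    (hc : c.IsCycleOn (Set.univ : Set (Fin (k + 2)))) : ∃ σ, cycleOfWord σ = c := by
  obtain ⟨hcyc, hsupp⟩ := isCycle_of_isCycleOn_univ hc
  have hconj : IsConj (finRotate (k + 2)) c := by
    apply isCycle_finRotate.isConj hcyc
    rw [hsupp, support_finRotate]
  obtain ⟨τ, hτ⟩ := isConj_iff.mp hconj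
  obtain ⟨j, hj⟩ := hc.2 (Set.mem_univ (τ 0)) (Set.mem_univ 0)
  obtain ⟨⟨p, σ⟩, hσ⟩ := Equiv.Perm.decomposeFin.symm.surjective (c ^ j * τ)
  have hp : p = 0 := by
    have := congrArg (fun e : Equiv.Perm (Fin (k + 2)) => e 0) hσ
    simpa [hj] using this
  subst hp
  refine ⟨σ, ?_⟩
  rw [cycleOfWord, hσ]
  calc c ^ j * τ * finRotate (k + 2) * (c ^ j * τ)⁻¹
      = c ^ j * (τ * finRotate (k + 2) * τ⁻¹) * (c ^ j)⁻¹ := by group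
    _ = c := by rw [hτ]; group

theorem descentCount_eq_card {k : ℕ} (σ : Equiv.Perm (Fin (k + 1))) :
    descentCount σ = #{i : Fin k | σ i.succ < σ i.castSucc} := by
  unfold descentCount descentSet permWord
  simp only [List.length_map, List.length_finRange, Nat.add_sub_cancel]
  rw [Finset.card_filter, Finset.card_filter, Finset.sum_range]
  refine Finset.sum_congr rfl fun i _ => ?_
  rw [List.getD_eq_getElem _ _ (by simp), List.getD_eq_getElem _ _ (by simp)]
  simp only [List.getElem_map, List.getElem_finRange, Nat.add_lt_add_iff_right, Fin.val_fin_lt]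
  rfl

theorem card_descents_cycleOfWord {k : ℕ} (σ : Equiv.Perm (Fin (k + 1))) :
    #{x | cycleOfWord σ x < x} = descentCount σ + 1 := by
  rw [descentCount_eq_card, Finset.card_filter, Finset.card_filter,
    ← Equiv.sum_comp (Equiv.Perm.decomposeFin.symm (0, σ))]
  simp only [cycleOfWord_apply]
  rw [Fin.sum_univ_succ, Fin.sum_univ_castSucc]
  have hr : ∀ i : Fin k, finRotate (k + 2) i.castSucc.succ = i.succ.succ := by
    intro i
    rw [Fin.succ_castSucc, finRotate_apply, Fin.coeSucc_eq_succ]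
  have hl : finRotate (k + 2) (Fin.last k).succ = 0 := by
    rw [Fin.succ_last]; exact finRotate_last
  simp only [hr, hl, decomposeFin_symm_zero_succ]
  simp

/-- The `n`-cycles of `Fin n` with `d + 1` cyclic descents are counted by `E(n - 1, d)`. -/
theorem card_cycles_descents (k d : ℕ) :
    #{c : Equiv.Perm (Fin (k + 2)) | c.IsCycleOn (Set.univ : Set (Fin (k + 2))) ∧
      #{x | c x < x} = d + 1} = eulerianNum (k + 1) d := by
  symm
  refine Finset.card_bij (fun σ _ => cycleOfWord σ) ?_ (fun _ _ _ _ h => cycleOfWord_injective h) ?_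
  · intro σ hσ
    have hσ' : descentCount σ = d := by simpa using hσ
    simp [isCycleOn_cycleOfWord, card_descents_cycleOfWord, hσ']
  · intro c hc
    obtain ⟨h1, h2⟩ := (Finset.mem_filter.mp hc).2
    obtain ⟨σ, rfl⟩ := exists_cycleOfWord_eq h1
    rw [card_descents_cycleOfWord] at h2
    exact ⟨σ, by simpa using h2, rfl⟩

theorem card_descents_inv {n : ℕ} (c : Equiv.Perm (Fin n)) :
    #{x | c⁻¹ x < x} = #{x | x < c x} := by
  symm
  refine Finset.card_equiv c fun x => ?_
  simp

theorem card_cycles_ascents (k d : ℕ) :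
    #{c : Equiv.Perm (Fin (k + 2)) | c.IsCycleOn (Set.univ : Set (Fin (k + 2))) ∧
      #{x | x < c x} = d + 1} = eulerianNum (k + 1) d := by
  rw [← card_cycles_descents]
  refine Finset.card_equiv (Equiv.inv _) fun c => ?_
  simp only [Finset.mem_filter, Finset.mem_univ, true_and, Equiv.inv_apply, card_descents_inv,
    Equiv.Perm.isCycleOn_inv]

theorem card_ascents_add_card_descents {k : ℕ} {c : Equiv.Perm (Fin (k + 2))}
    (hc : c.IsCycleOn (Set.univ : Set (Fin (k + 2)))) :
    #{x | x < c x} + #{x | c x < x} = k + 2 := by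
  have hne : ∀ x, c x ≠ x := fun x => hc.apply_ne Set.nontrivial_univ (Set.mem_univ x)
  have h : #{x | c x < x} = #{x | ¬ x < c x} := by
    congr 1
    ext x
    simp [(hne x).le_iff_lt]
  rw [h, Finset.card_filter_add_card_filter_not]
  simp

theorem permM_of_isCycleOn {k : ℕ} {c : Equiv.Perm (Fin (k + 2))}
    (hc : c.IsCycleOn (Set.univ : Set (Fin (k + 2)))) :
    permM c = min #{x | x < c x} #{x | c x < x} := by
  obtain ⟨hcyc, hsupp⟩ := isCycle_of_isCycleOn_univ hc
  have hf := hcyc.cycleFactorsFinset_eq_singleton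
  have : permM c = cycleM c := by
    unfold permM
    convert Finset.sum_singleton cycleM c
  rw [this, cycleM]
  congr! 3

theorem cycle_M_count :
    cycCount 1 0 = 1 ∧
      ∀ n : ℕ, Odd n → 3 ≤ n → ∀ d : ℕ,
        ((n - 1) / 2 < d → cycCount n d = 0) ∧
        (1 ≤ d → d ≤ (n - 1) / 2 → cycCount n d = 2 * eulerianNum (n - 1) (d - 1)) := by
  refine ⟨?_, fun n hodd hn d => ?_⟩
  · rw [cycCount, Finset.card_eq_one]
    refine ⟨1, Finset.eq_singleton_iff_unique_mem.mpr
      ⟨?_, fun _ _ => Subsingleton.elim _ _⟩⟩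
    have hf : (1 : Equiv.Perm (Fin 1)).cycleFactorsFinset = ∅ :=
      Equiv.Perm.cycleFactorsFinset_one
    refine Finset.mem_filter.mpr ⟨Finset.mem_univ _, by simpa using Set.subsingleton_univ, ?_⟩
    unfold permM
    convert Finset.sum_empty
  · obtain ⟨k, rfl⟩ : ∃ k, n = k + 2 := ⟨n - 2, by omega⟩
    obtain ⟨r, hr⟩ := hodd
    constructor
    · intro hd
      rw [cycCount, Finset.card_eq_zero, Finset.filter_eq_empty_iff]
      rintro c - ⟨hc, hM⟩
      rw [permM_of_isCycleOn hc] at hM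
      have := card_ascents_add_card_descents hc
      omega
    · intro h1 h2
      obtain ⟨e, rfl⟩ : ∃ e, d = e + 1 := ⟨d - 1, by omega⟩
      have hsplit : cycCount (k + 2) (e + 1) =
          #(({c : Equiv.Perm (Fin (k + 2)) | c.IsCycleOn (Set.univ : Set (Fin (k + 2))) ∧
            #{x | x < c x} = e + 1} : Finset _) ∪
          ({c : Equiv.Perm (Fin (k + 2)) | c.IsCycleOn (Set.univ : Set (Fin (k + 2))) ∧
            #{x | c x < x} = e + 1} : Finset _)) := by
        rw [cycCount, ← Finset.filter_or]
        congr 1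
        refine Finset.filter_congr fun c _ => ?_
        rw [← and_or_left]
        refine and_congr_right fun hc => ?_
        rw [permM_of_isCycleOn hc]
        have := card_ascents_add_card_descents hc
        omega
      rw [hsplit, Finset.card_union_of_disjoint, card_cycles_ascents, card_cycles_descents]
      · simp [two_mul]
      · rw [Finset.disjoint_filter]
        rintro c - ⟨hc, ha⟩ ⟨-, hd⟩
        have := card_ascents_add_card_descents hc
        omega
end

section
/- Let n, r, s be nonnegative integers with n ≥ r + s, and let c, d be real numbers. Then 2·Σ_{k even, 0 ≤ k ≤ n} C(n,k)·C(n−k,r)·C(k,s)·c^{n−k}·d^{k} = C(n,r)·C(n−r,s)·c^{r}·d^{s}·((c+d)^{n−r−s} + (−1)^{s}·(c−d)^{n−r−s}), where C(·,·) denotes the binomial coefficient (equal to 0 when the lower index exceeds the upper index). -/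
open Finset
open scoped Classical

theorem choose_mul_choose_mul_choose_add (r s i j : ℕ) :
    (r + s + (i + j)).choose (s + j) * (r + i).choose r * (s + j).choose s =
      (r + s + (i + j)).choose r * (s + (i + j)).choose s * (i + j).choose j := by
  have h₁ := Nat.choose_mul (n := r + s + (i + j)) (Nat.le_add_right r i)
  have h₂ := Nat.choose_mul (n := s + (i + j)) (Nat.le_add_right s j)
  rw [Nat.choose_symm_of_eq_add (show r + s + (i + j) = (r + i) + (s + j) by ring),
    show r + s + (i + j) - r = s + (i + j) by lia, Nat.add_sub_cancel_left,
    Nat.choose_symm_of_eq_add (show s + (i + j) = i + (s + j) by ring)] at h₁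
  rw [Nat.add_sub_cancel_left, Nat.add_sub_cancel_left] at h₂
  rw [h₁, mul_assoc, h₂, mul_assoc]

theorem sum_choose_mul_choose_mul_choose {R : Type*} [CommSemiring R] (r s m : ℕ) (c d : R) :
    ∑ k ∈ Finset.range (r + s + m + 1),
        ((r + s + m).choose k : R) * ((r + s + m - k).choose r : R) * (k.choose s : R) *
          c ^ (r + s + m - k) * d ^ k =
      ((r + s + m).choose r : R) * ((s + m).choose s : R) * c ^ r * d ^ s * (c + d) ^ m := by
  rw [show r + s + m + 1 = s + (m + 1) + r by ring, Finset.sum_range_add, Finset.sum_range_add,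
    Finset.sum_eq_zero (s := Finset.range s), Finset.sum_eq_zero (s := Finset.range r), zero_add,
    add_zero, add_comm c d, add_pow, Finset.mul_sum]
  · refine Finset.sum_congr rfl fun j hj => ?_
    obtain ⟨i, rfl⟩ := Nat.exists_eq_add_of_le' (Finset.mem_range_succ_iff.mp hj)
    have key := congrArg (Nat.cast : ℕ → R) (choose_mul_choose_mul_choose_add r s i j)
    push_cast at key
    rw [show r + s + (i + j) - (s + j) = r + i by lia, Nat.add_sub_cancel, key]
    ring
  · intro x _
    rw [Nat.choose_eq_zero_of_lt (show r + s + m - (s + (m + 1) + x) < r by grind)]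
    simp
  · intro x hx
    rw [Nat.choose_eq_zero_of_lt (Finset.mem_range.mp hx)]
    simp

theorem two_mul_sum_filter_even_mul_pow {R : Type*} [CommRing R] (t : Finset ℕ) (a : ℕ → R)
    (d : R) :
    2 * ∑ k ∈ t.filter (fun k => Even k), a k * d ^ k =
      ∑ k ∈ t, a k * d ^ k + ∑ k ∈ t, a k * (-d) ^ k := by
  rw [Finset.sum_filter, Finset.mul_sum, ← Finset.sum_add_distrib]
  refine Finset.sum_congr rfl fun k _ => ?_
  split_ifs with hk
  · rw [hk.neg_pow, two_mul]
  · rw [(Nat.not_even_iff_odd.mp hk).neg_pow]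
    ring

theorem binomial_even_sum_identity (n r s : ℕ) (h : r + s ≤ n) (c d : ℝ) :
    2 * ∑ k ∈ (Finset.range (n + 1)).filter (fun k => Even k),
        (n.choose k : ℝ) * ((n - k).choose r : ℝ) * (k.choose s : ℝ) * c ^ (n - k) * d ^ k =
      (n.choose r : ℝ) * ((n - r).choose s : ℝ) * c ^ r * d ^ s *
        ((c + d) ^ (n - r - s) + (-1) ^ s * (c - d) ^ (n - r - s)) := by
  obtain ⟨m, rfl⟩ := Nat.exists_eq_add_of_le h
  rw [two_mul_sum_filter_even_mul_pow, sum_choose_mul_choose_mul_choose,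
    sum_choose_mul_choose_mul_choose, show r + s + m - r = s + m by lia, Nat.add_sub_cancel_left,
    neg_pow d s]
  ring
end

section
/- For all n ≥ 2, the number of permutations π of {1,…,n} such that position 1 is a descent, position 2 is an ascent, and positions 3, 4, …, n−1 contain exactly one descent, equals (n−2)·2^{n−1} − (1/2)·(3n−1)·(n−2). -/
open Finset
open scoped Classical

/-- `f(10,n)`: the number of permutations of `{1,…,n}` whose first position is a
descent, second position is an ascent, and whose remaining positions contain exactly
one descent.  (Positions are 0-indexed here; the paper's positions `1,2` and
`3,…,n-1` correspond to `0,1` and `2,…,n-2`.) -/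
noncomputable def f10Count (n : ℕ) : ℕ :=
  (Finset.univ.filter fun π : Equiv.Perm (Fin n) =>
    0 ∈ descentSet (permWord π) ∧ 1 ∈ ascentSet (permWord π) ∧
      ((descentSet (permWord π)).filter fun i => 2 ≤ i).card = 1).card

/-- The letter `p` occurs in the word `w` somewhere before the letter `q`. -/
def OccursBefore {n : ℕ} (p q : Fin 3) (w : Fin n → Fin 3) : Prop :=
  ∃ i j, i < j ∧ w i = p ∧ w j = q

/-- Number of words of length `n` over `Fin 3` satisfying `P`. -/
noncomputable def wordCount (n : ℕ) (P : (Fin n → Fin 3) → Prop) : ℕ :=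
  (univ.filter P).card

/-- Exactly one position of `w` carries the letter `0`. -/
def ZeroOnce {n : ℕ} (w : Fin n → Fin 3) : Prop := ∃! i, w i = 0

/-- The colourings that encode the permutations counted by `f10Count`: the letter at `x` records
the block (first entry, first run, second run) that contains the value `x`. -/
def IsGoodColouring {n : ℕ} (w : Fin n → Fin 3) : Prop :=
  ZeroOnce w ∧ OccursBefore 1 0 w ∧ OccursBefore 1 1 w ∧ OccursBefore 2 1 w

lemma occursBefore_cons {n : ℕ} (p q x : Fin 3) (u : Fin n → Fin 3) :
    OccursBefore p q (Fin.cons x u : Fin (n + 1) → Fin 3) ↔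
      (x = p ∧ ∃ j, u j = q) ∨ OccursBefore p q u := by
  simp [OccursBefore, Fin.exists_fin_succ]

lemma not_occursBefore_zero (p q : Fin 3) (w : Fin 0 → Fin 3) : ¬ OccursBefore p q w := by
  rintro ⟨i, -⟩
  exact i.elim0

lemma zeroOnce_cons_zero {n : ℕ} (u : Fin n → Fin 3) :
    ZeroOnce (Fin.cons 0 u : Fin (n + 1) → Fin 3) ↔ ∀ i, u i ≠ 0 := by
  simp [ZeroOnce, ExistsUnique, Fin.exists_fin_succ, Fin.forall_fin_succ, Fin.succ_ne_zero]
  intro x hx h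
  exact absurd h.symm (Fin.succ_ne_zero x)

lemma zeroOnce_cons_of_ne {n : ℕ} {x : Fin 3} (hx : x ≠ 0) (u : Fin n → Fin 3) :
    ZeroOnce (Fin.cons x u : Fin (n + 1) → Fin 3) ↔ ZeroOnce u := by
  simp [ZeroOnce, ExistsUnique, Fin.exists_fin_succ, Fin.forall_fin_succ, hx]

lemma ZeroOnce.exists {n : ℕ} {w : Fin n → Fin 3} (h : ZeroOnce w) : ∃ i, w i = 0 :=
  ExistsUnique.exists h

lemma not_zeroOnce_zero (w : Fin 0 → Fin 3) : ¬ ZeroOnce w := by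
  rintro ⟨i, -⟩
  exact i.elim0

lemma OccursBefore.exists_right {n : ℕ} {p q : Fin 3} {w : Fin n → Fin 3}
    (h : OccursBefore p q w) : ∃ i, w i = q := by
  obtain ⟨i, j, -, -, h⟩ := h
  exact ⟨j, h⟩

lemma wordCount_congr {n : ℕ} {P Q : (Fin n → Fin 3) → Prop} (h : ∀ w, P w ↔ Q w) :
    wordCount n P = wordCount n Q := by
  rw [show P = Q from funext fun w => propext (h w)]

lemma wordCount_false {n : ℕ} {P : (Fin n → Fin 3) → Prop} (h : ∀ w, ¬ P w) :
    wordCount n P = 0 := by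
  simp [wordCount, h]

lemma wordCount_succ (n : ℕ) (P : (Fin (n + 1) → Fin 3) → Prop) :
    wordCount (n + 1) P = wordCount n (fun u => P (Fin.cons 0 u)) +
      wordCount n (fun u => P (Fin.cons 1 u)) + wordCount n (fun u => P (Fin.cons 2 u)) := by
  have h : ∀ (k : ℕ) (Q : (Fin k → Fin 3) → Prop),
      wordCount k Q = ∑ w : Fin k → Fin 3, if Q w then 1 else 0 := fun k Q => by
    simp [wordCount]
  simp only [h]
  rw [← (Fin.consEquiv fun _ : Fin (n + 1) => Fin 3).sum_comp, Fintype.sum_prod_type,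
    Fin.sum_univ_three]
  rfl

lemma wordCount_ne_zero (n : ℕ) : wordCount n (fun w => ∀ i, w i ≠ 0) = 2 ^ n := by
  induction n with
  | zero => simp [wordCount]
  | succ n ih =>
    rw [wordCount_succ]
    simp only [Fin.forall_fin_succ, Fin.cons_zero, Fin.cons_succ]
    rw [wordCount_false (by simp), wordCount_congr (Q := fun w => ∀ i, w i ≠ 0) (by simp),
      wordCount_congr (P := fun w => (2 : Fin 3) ≠ 0 ∧ _) (Q := fun w => ∀ i, w i ≠ 0) (by simp),
      ih]
    ring

lemma wordCount_ne_zero_one (n : ℕ) :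
    wordCount n (fun w => (∀ i, w i ≠ 0) ∧ ∃ i, w i = 1) + 1 = 2 ^ n := by
  induction n with
  | zero => simp [wordCount]
  | succ n ih =>
    rw [wordCount_succ]
    simp only [Fin.forall_fin_succ, Fin.exists_fin_succ, Fin.cons_zero, Fin.cons_succ]
    rw [wordCount_false (by simp), wordCount_congr (Q := fun w => ∀ i, w i ≠ 0) (by simp),
      wordCount_congr (P := fun w => ((2 : Fin 3) ≠ 0 ∧ _) ∧ _)
        (Q := fun w => (∀ i, w i ≠ 0) ∧ ∃ i, w i = 1) (by simp), wordCount_ne_zero]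
    omega

lemma wordCount_ne_zero_two_one (n : ℕ) :
    wordCount n (fun w => (∀ i, w i ≠ 0) ∧ OccursBefore 2 1 w) + n + 1 = 2 ^ n := by
  induction n with
  | zero => simp [wordCount, not_occursBefore_zero]
  | succ n ih =>
    rw [wordCount_succ]
    simp only [Fin.forall_fin_succ, occursBefore_cons, Fin.cons_zero, Fin.cons_succ]
    rw [wordCount_false (by simp),
      wordCount_congr (Q := fun w => (∀ i, w i ≠ 0) ∧ OccursBefore 2 1 w) (by simp),
      wordCount_congr (P := fun w => ((2 : Fin 3) ≠ 0 ∧ _) ∧ _)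
        (Q := fun w => (∀ i, w i ≠ 0) ∧ ∃ i, w i = 1)
        (by simpa using fun w _ => OccursBefore.exists_right)]
    have := wordCount_ne_zero_one n
    omega

lemma wordCount_zeroOnce (n : ℕ) : 2 * wordCount n ZeroOnce = n * 2 ^ n := by
  induction n with
  | zero => simp [wordCount, not_zeroOnce_zero]
  | succ n ih =>
    rw [wordCount_succ]
    simp only [zeroOnce_cons_zero, zeroOnce_cons_of_ne, ne_eq, one_ne_zero, not_false_eq_true,
      (by decide : (2 : Fin 3) ≠ 0)]
    have := wordCount_ne_zero n
    simp only [ne_eq] at this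
    rw [this, pow_succ]
    linarith

lemma wordCount_zeroOnce_one (n : ℕ) :
    2 * wordCount n (fun w => ZeroOnce w ∧ ∃ i, w i = 1) + 2 * n = n * 2 ^ n := by
  induction n with
  | zero => simp [wordCount, not_zeroOnce_zero]
  | succ n ih =>
    rw [wordCount_succ]
    simp only [zeroOnce_cons_zero, zeroOnce_cons_of_ne, ne_eq, one_ne_zero, not_false_eq_true,
      (by decide : (2 : Fin 3) ≠ 0), Fin.exists_fin_succ, Fin.cons_zero, Fin.cons_succ,
      zero_ne_one, false_or, true_or, and_true, (by decide : (2 : Fin 3) ≠ 1)]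
    have h1 := wordCount_ne_zero_one n
    have h2 := wordCount_zeroOnce n
    simp only [ne_eq] at h1
    change 2 * (_ + wordCount n ZeroOnce + _) + _ = _
    rw [pow_succ]
    linarith

lemma wordCount_zeroOnce_two_one (n : ℕ) :
    2 * wordCount n (fun w => ZeroOnce w ∧ OccursBefore 2 1 w) + 2 * n ^ 2 = n * 2 ^ n := by
  induction n with
  | zero => simp [wordCount, not_zeroOnce_zero]
  | succ n ih =>
    rw [wordCount_succ]
    simp only [zeroOnce_cons_zero, zeroOnce_cons_of_ne, ne_eq, one_ne_zero, not_false_eq_true,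
      (by decide : (2 : Fin 3) ≠ 0), occursBefore_cons, (by decide : (0 : Fin 3) ≠ 2),
      (by decide : (1 : Fin 3) ≠ 2), false_and, false_or, true_and,
      or_iff_left_of_imp OccursBefore.exists_right]
    have h1 := wordCount_ne_zero_two_one n
    have h2 := wordCount_zeroOnce_one n
    simp only [ne_eq] at h1
    rw [pow_succ 2]
    linarith

lemma wordCount_zeroOnce_one_zero_one_one (n : ℕ) :
    2 * wordCount n (fun w => ZeroOnce w ∧ OccursBefore 1 0 w ∧ OccursBefore 1 1 w) +
      n * n + 2 * 2 ^ n = n * 2 ^ n + 2 + n := by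
  induction n with
  | zero => simp [wordCount, not_zeroOnce_zero]
  | succ n ih =>
    rw [wordCount_succ, wordCount_false]
    · rw [wordCount_congr (Q := fun w => ZeroOnce w ∧ ∃ i, w i = 1),
        wordCount_congr (P := fun w => ZeroOnce (Fin.cons 2 w : Fin (n + 1) → Fin 3) ∧ _)
          (Q := fun w => ZeroOnce w ∧ OccursBefore 1 0 w ∧ OccursBefore 1 1 w)]
      · have := wordCount_zeroOnce_one n
        rw [pow_succ]
        linarith
      · intro w
        simp [zeroOnce_cons_of_ne, occursBefore_cons]
      · intro w
        rw [zeroOnce_cons_of_ne one_ne_zero, occursBefore_cons, occursBefore_cons]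
        have h0 := ZeroOnce.exists (w := w)
        have h1 := OccursBefore.exists_right (p := 1) (q := 1) (w := w)
        tauto
    · intro w
      rw [zeroOnce_cons_zero, occursBefore_cons]
      rintro ⟨h, h' | h', -⟩
      · simp at h'
      · obtain ⟨i, hi⟩ := h'.exists_right
        exact h i hi

lemma wordCount_isGoodColouring (n : ℕ) :
    2 * wordCount (n + 1) IsGoodColouring + 3 * n ^ 2 + 2 * 2 ^ n = 2 * n * 2 ^ n + 2 + n := by
  rw [wordCount_succ, wordCount_false]
  · rw [wordCount_congr (Q := fun w => ZeroOnce w ∧ OccursBefore 2 1 w),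
      wordCount_congr (P := fun w => IsGoodColouring (Fin.cons 2 w : Fin (n + 1) → Fin 3))
        (Q := fun w => ZeroOnce w ∧ OccursBefore 1 0 w ∧ OccursBefore 1 1 w)]
    · have h1 := wordCount_zeroOnce_two_one n
      have h2 := wordCount_zeroOnce_one_zero_one_one n
      linarith
    · intro w
      have h1 := OccursBefore.exists_right (p := 1) (q := 1) (w := w)
      simp [IsGoodColouring, zeroOnce_cons_of_ne, occursBefore_cons]
      tauto
    · intro w
      have h0 := ZeroOnce.exists (w := w)
      have h1 := OccursBefore.exists_right (p := 2) (q := 1) (w := w)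
      simp [IsGoodColouring, zeroOnce_cons_of_ne, occursBefore_cons]
      tauto
  · intro w
    rw [IsGoodColouring, zeroOnce_cons_zero, occursBefore_cons]
    rintro ⟨h, h' | h', -⟩
    · simp at h'
    · obtain ⟨i, hi⟩ := h'.exists_right
      exact h i hi

/-- `π` has a descent at position `0`, and its only other descent is at position `d ≥ 2`. -/
structure HasDescentsZeroAnd {n : ℕ} (π : Equiv.Perm (Fin n)) (d : ℕ) : Prop where
  two_le : 2 ≤ d
  lt : d + 1 < n
  descent_zero : ∀ i j : Fin n, i.val = 0 → j.val = 1 → π j < π i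
  descent_iff : ∀ i j : Fin n, 1 ≤ i.val → j.val = i.val + 1 → (π j < π i ↔ i.val = d)

lemma HasDescentsZeroAnd.unique {n : ℕ} {π : Equiv.Perm (Fin n)} {d e : ℕ}
    (hd : HasDescentsZeroAnd π d) (he : HasDescentsZeroAnd π e) : d = e := by
  have h2 := hd.two_le
  have hlt := hd.lt
  have h := (hd.descent_iff ⟨d, by omega⟩ ⟨d + 1, hlt⟩ (by simp; omega) rfl).2 rfl
  exact (he.descent_iff ⟨d, by omega⟩ ⟨d + 1, hlt⟩ (by simp; omega) rfl).1 h

lemma permWord_getD {n : ℕ} (π : Equiv.Perm (Fin n)) (i : Fin n) :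
    (permWord π).getD i 0 = (π i : ℕ) + 1 := by
  simp [permWord]

lemma mem_descentSet_permWord {n : ℕ} (π : Equiv.Perm (Fin n)) (k : ℕ) :
    k ∈ descentSet (permWord π) ↔ ∃ i j : Fin n, i.val = k ∧ j.val = k + 1 ∧ π j < π i := by
  have hlen : (permWord π).length = n := by simp [permWord]
  simp only [descentSet, mem_filter, mem_range, hlen]
  constructor
  · rintro ⟨hk, h⟩
    have hi := permWord_getD π ⟨k, by omega⟩
    have hj := permWord_getD π ⟨k + 1, by omega⟩
    refine ⟨⟨k, by omega⟩, ⟨k + 1, by omega⟩, rfl, rfl, Fin.lt_def.2 ?_⟩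
    simp only at hi hj
    omega
  · rintro ⟨i, j, rfl, hj, h⟩
    rw [← hj, permWord_getD, permWord_getD]
    have := Fin.lt_def.1 h
    omega

lemma mem_ascentSet_permWord {n : ℕ} (π : Equiv.Perm (Fin n)) (k : ℕ) :
    k ∈ ascentSet (permWord π) ↔ ∃ i j : Fin n, i.val = k ∧ j.val = k + 1 ∧ π i < π j := by
  have hlen : (permWord π).length = n := by simp [permWord]
  simp only [ascentSet, mem_filter, mem_range, hlen]
  constructor
  · rintro ⟨hk, h⟩
    have hi := permWord_getD π ⟨k, by omega⟩
    have hj := permWord_getD π ⟨k + 1, by omega⟩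
    refine ⟨⟨k, by omega⟩, ⟨k + 1, by omega⟩, rfl, rfl, Fin.lt_def.2 ?_⟩
    simp only at hi hj
    omega
  · rintro ⟨i, j, rfl, hj, h⟩
    rw [← hj, permWord_getD, permWord_getD]
    have := Fin.lt_def.1 h
    omega

lemma exists_hasDescentsZeroAnd_iff {n : ℕ} (π : Equiv.Perm (Fin n)) :
    (0 ∈ descentSet (permWord π) ∧ 1 ∈ ascentSet (permWord π) ∧
      ((descentSet (permWord π)).filter fun i => 2 ≤ i).card = 1) ↔
      ∃ d, HasDescentsZeroAnd π d := by
  simp only [card_eq_one, Finset.ext_iff, mem_filter, mem_singleton, mem_descentSet_permWord,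
    mem_ascentSet_permWord]
  constructor
  · rintro ⟨⟨i₀, j₀, hi₀, hj₀, h₀⟩, ⟨i₁, j₁, hi₁, hj₁, h₁⟩, d, hd⟩
    obtain ⟨⟨i, j, hi, hj, -⟩, h2⟩ := (hd d).2 rfl
    refine ⟨d, h2, by omega, fun i j hi hj => ?_, fun i j hi hj => ⟨fun h => ?_, fun h => ?_⟩⟩
    · rwa [show i = i₀ by omega, show j = j₀ by omega]
    · by_cases h1 : i.val = 1
      · rw [show i = i₁ by omega, show j = j₁ by omega] at h
        exact absurd h h₁.asymm
      · exact (hd i).1 ⟨⟨i, j, rfl, hj, h⟩, by omega⟩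
    · obtain ⟨⟨i', j', hi', hj', h'⟩, -⟩ := (hd d).2 rfl
      rwa [show i = i' by omega, show j = j' by omega]
  · rintro ⟨d, h2, hlt, h0, h⟩
    refine ⟨⟨⟨0, by omega⟩, ⟨1, by omega⟩, rfl, rfl, h0 _ _ rfl rfl⟩,
      ⟨⟨1, by omega⟩, ⟨2, by omega⟩, rfl, rfl, ?_⟩, d, fun k => ⟨?_, ?_⟩⟩
    · refine lt_of_le_of_ne (not_lt.1 fun h' => ?_) (π.injective.ne (by simp))
      have := (h ⟨1, by omega⟩ ⟨2, by omega⟩ le_rfl rfl).1 h'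
      simp only at this
      omega
    · rintro ⟨⟨i, j, rfl, hj, hlt'⟩, hk⟩
      exact (h i j (by omega) hj).1 hlt'
    · rintro rfl
      exact ⟨⟨⟨k, by omega⟩, ⟨k + 1, by omega⟩, rfl, rfl,
        (h _ _ (by simp; omega) rfl).2 rfl⟩, h2⟩

/-- The sorted word `0 1 ⋯ 1 2 ⋯ 2` whose letters `1` occupy the positions `1, …, d`. -/
def blockWord (d i : ℕ) : Fin 3 := if i = 0 then 0 else if i ≤ d then 1 else 2

lemma HasDescentsZeroAnd.lt_of_blockWord_eq {n : ℕ} {π : Equiv.Perm (Fin n)} {d : ℕ}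
    (hd : HasDescentsZeroAnd π d) {i j : Fin n} (hij : i < j)
    (h : blockWord d i = blockWord d j) : π i < π j := by
  obtain ⟨j, hj⟩ := j
  induction j with
  | zero => exact absurd hij (by simp [Fin.lt_def])
  | succ j ih =>
    have hij' : i.val ≤ j := by simpa [Fin.lt_def, Nat.lt_succ_iff] using hij
    have hblock : 1 ≤ i.val ∧ j ≠ d ∧ blockWord d i = blockWord d j := by
      simp only [blockWord] at h ⊢
      grind
    have hstep : π ⟨j, by omega⟩ < π ⟨j + 1, hj⟩ := by
      refine lt_of_le_of_ne (not_lt.1 fun h' => ?_) (π.injective.ne (by simp))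
      exact hblock.2.1 ((hd.descent_iff ⟨j, by omega⟩ ⟨j + 1, hj⟩ (by simp; omega) rfl).1 h')
    rcases hij'.eq_or_lt with rfl | hlt
    · exact hstep
    · exact (ih (by omega) (Fin.lt_def.2 hlt) hblock.2.2).trans hstep

lemma blockWord_monotone (d : ℕ) : Monotone (blockWord d) := by
  intro i j hij
  simp only [blockWord]
  split_ifs <;> omega

lemma HasDescentsZeroAnd.exists_colouring {n : ℕ} {π : Equiv.Perm (Fin n)} {d : ℕ}
    (hd : HasDescentsZeroAnd π d) :
    ∃ c : Fin n → Fin 3, IsGoodColouring c ∧ Tuple.sort c = π := by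
  have h2 := hd.two_le
  have hlt := hd.lt
  refine ⟨fun x => blockWord d (π.symm x), ⟨⟨π ⟨0, by omega⟩, by simp [blockWord], ?_⟩,
    ⟨π ⟨1, by omega⟩, π ⟨0, by omega⟩, hd.descent_zero _ _ rfl rfl, ?_, ?_⟩,
    ⟨π ⟨1, by omega⟩, π ⟨2, by omega⟩, hd.lt_of_blockWord_eq (by simp) ?_, ?_, ?_⟩,
    ⟨π ⟨d + 1, hlt⟩, π ⟨d, by omega⟩, (hd.descent_iff _ _ (by simp; omega) rfl).2 rfl, ?_, ?_⟩⟩,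
    (Tuple.eq_sort_iff.2 ⟨?_, ?_⟩).symm⟩
  · intro y hy
    rw [← Equiv.symm_apply_eq]
    ext
    simp only [blockWord] at hy
    split_ifs at hy with h <;> simp_all
  any_goals grind [blockWord]
  · intro i j hij
    simpa using blockWord_monotone d hij
  · intro i j hij h
    exact hd.lt_of_blockWord_eq hij (by simpa using h)

lemma IsGoodColouring.exists_hasDescentsZeroAnd {n : ℕ} {c : Fin n → Fin 3}
    (hc : IsGoodColouring c) : ∃ d, HasDescentsZeroAnd (Tuple.sort c) d ∧
      ∀ i, c (Tuple.sort c i) = blockWord d i := by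
  obtain ⟨hmono, hstable⟩ := Tuple.eq_sort_iff.1 (rfl : Tuple.sort c = Tuple.sort c)
  generalize Tuple.sort c = π at hmono hstable ⊢
  obtain ⟨⟨a, ha, ha'⟩, ⟨x, a', hxa, hx, hza⟩, ⟨y, z, hyz, hy, hz⟩, ⟨u, v, huv, hu, hv⟩⟩ := hc
  obtain rfl := ha' a' hza
  obtain ⟨a, rfl⟩ := π.surjective a'
  obtain ⟨x, rfl⟩ := π.surjective x
  obtain ⟨y, rfl⟩ := π.surjective y
  obtain ⟨z, rfl⟩ := π.surjective z
  obtain ⟨u, rfl⟩ := π.surjective u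
  obtain ⟨v, rfl⟩ := π.surjective v
  have hzero : ∀ i, c (π i) = 0 → i = a := fun i hi => π.injective (ha' _ hi)
  have hle : ∀ i j, i ≤ j → c (π i) ≤ c (π j) := fun i j hij => hmono hij
  have hstable' : ∀ i j, i ≤ j → c (π i) = c (π j) → π i ≤ π j := fun i j hij h =>
    hij.eq_or_lt.elim (fun e => e ▸ le_rfl) fun h' => (hstable i j h' h).le
  have ha0 : a.val = 0 := by
    have h := hle ⟨0, a.pos⟩ a (Fin.le_def.2 (Nat.zero_le _))
    rw [ha] at h
    rw [← hzero _ (Fin.le_zero_iff.1 h)]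
  obtain ⟨e, he, hmax⟩ := (univ.filter fun i => c (π i) = 1).exists_max_image id ⟨x, by simpa⟩
  simp only [mem_filter, mem_univ, true_and, id] at he hmax
  have hpos : ∀ i, c (π i) ≠ 0 → 1 ≤ i.val := fun i hi => by
    by_contra h
    exact hi (by rwa [show i = a by omega])
  have hform : ∀ i, c (π i) = blockWord e i := by
    intro i
    simp only [blockWord]
    split_ifs with h0 h1
    · rwa [show i = a by omega]
    · have h := hle i e (Fin.le_def.2 h1)
      have : c (π i) ≠ 0 := fun h => h0 (by rw [hzero i h, ha0])
      omega
    · have : c (π i) ≠ 0 := fun h => h0 (by rw [hzero i h, ha0])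
      have : c (π i) ≠ 1 := fun h => h1 (hmax i h)
      omega
  have hx1 := hpos x (by simp [hx])
  have hy1 := hpos y (by simp [hy])
  have hz1 := hpos z (by simp [hz])
  have hye := Fin.le_def.1 (hmax y hy)
  have hze := Fin.le_def.1 (hmax z hz)
  have hyz' : y.val ≠ z.val := fun h => hyz.ne (by rw [Fin.ext h])
  have heu : e.val < u.val := by
    by_contra h
    have := hle u e (Fin.le_def.2 (by omega))
    rw [hu, he] at this
    exact absurd this (by decide)
  refine ⟨e, ⟨by omega, by omega, fun i j hi hj => ?_, fun i j hi hj => ⟨?_, fun h => ?_⟩⟩, hform⟩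
  · rw [show i = a by omega]
    refine (hstable' j x (Fin.le_def.2 (by omega)) ?_).trans_lt hxa
    rw [hx, hform, blockWord, if_neg (by omega), if_pos (by omega)]
  · contrapose!
    intro hne
    refine (hstable i j (Fin.lt_def.2 (by omega)) ?_).le
    rw [hform, hform]
    simp only [blockWord]
    split_ifs <;> first | rfl | omega
  · have hj : π j ≤ π u := hstable' j u (Fin.le_def.2 (by omega)) (by
      rw [hu, hform, blockWord, if_neg (by omega), if_neg (by omega)])
    rw [show i = e by omega]
    exact hj.trans_lt (huv.trans_le (hstable' v e (hmax v hv) (by rw [hv, he])))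

lemma f10Count_eq_wordCount (n : ℕ) : f10Count n = wordCount n IsGoodColouring := by
  symm
  refine card_nbij Tuple.sort (fun c hc => ?_) (fun c hc c' hc' h => ?_) fun π hπ => ?_
  · obtain ⟨d, hd, -⟩ := (mem_filter.1 hc).2.exists_hasDescentsZeroAnd
    exact mem_filter.2 ⟨mem_univ _, (exists_hasDescentsZeroAnd_iff _).2 ⟨d, hd⟩⟩
  · obtain ⟨d, hd, hcd⟩ := (mem_filter.1 hc).2.exists_hasDescentsZeroAnd
    obtain ⟨d', hd', hcd'⟩ := (mem_filter.1 hc').2.exists_hasDescentsZeroAnd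
    rw [← h] at hd' hcd'
    obtain rfl := hd.unique hd'
    refine (Tuple.sort c).surjective.injective_comp_right (funext fun i => ?_)
    exact (hcd i).trans (hcd' i).symm
  · obtain ⟨d, hd⟩ := (exists_hasDescentsZeroAnd_iff π).1 (mem_filter.1 hπ).2
    obtain ⟨c, hc, hcπ⟩ := hd.exists_colouring
    exact ⟨c, mem_filter.2 ⟨mem_univ _, hc⟩, hcπ⟩

theorem f10_formula (n : ℕ) (hn : 2 ≤ n) :
    (f10Count n : ℚ) =
      ((n : ℚ) - 2) * 2 ^ (n - 1) - (1 / 2) * (3 * (n : ℚ) - 1) * ((n : ℚ) - 2) := by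
  obtain ⟨m, rfl⟩ : ∃ m, n = m + 1 := ⟨n - 1, by omega⟩
  have h := congrArg (Nat.cast (R := ℚ)) (wordCount_isGoodColouring m)
  rw [f10Count_eq_wordCount]
  push_cast at h ⊢
  linarith
end
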